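/- Let q = 2^r with r ≥ 2 an integer. Set N₃ = |SO⁺(4,q)| = q²(q²−1)², and for 0 ≤ j ≤ N₃ let C_{3,j} denote the number of codewords of Hamming weight j in the binary code C(SO⁺(4,q)). Then for every integer h ≥ 1, the identity MK^{2h} = Σ_{l=0}^{h−1} (−1)^{h+l+1} binom(h,l) (q⁴ − q³ − 2q² + q + 1)^{h−l} MK^{2l} + q^{1−2h} · Σ_{j=0}^{min(N₃,h)} (−1)^{h+j} C_{3,j} Σ_{t=j}^{h} t! S(h,t) 2^{h−t} binom(N₃−j, N₃−t) holds (an identity in ℚ). -/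

import Mathlib

open Finset Matrix

/-- The quadratic form `θ⁺(x) = ∑ i, x_i x_{n+i}` on `F^{2n}` (columns indexed by `Fin n ⊕ Fin n`). -/
def thetaPlus (F : Type) [Field F] (n : ℕ) (x : Fin n ⊕ Fin n → F) : F :=
  ∑ i : Fin n, x (Sum.inl i) * x (Sum.inr i)

/-- The orthogonal group `O⁺(2n,q)`: invertible matrices preserving `θ⁺`. -/
noncomputable def OplusGrp (F : Type) [Field F] [Fintype F] [DecidableEq F] (n : ℕ) :
    Finset (Matrix (Fin n ⊕ Fin n) (Fin n ⊕ Fin n) F) := by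
  classical
  exact Finset.univ.filter (fun w => IsUnit w ∧
    ∀ x : Fin n ⊕ Fin n → F, thetaPlus F n (w.mulVec x) = thetaPlus F n x)

/-- `SO⁺(2n,q)`: the kernel of `δ⁺(w) = Tr(B ᵗC)` on `O⁺(2n,q)`,
where `w = [[A,B],[C,D]]` in `n × n` blocks. -/
noncomputable def SOplusGrp (F : Type) [Field F] [Fintype F] [DecidableEq F] (n : ℕ) :
    Finset (Matrix (Fin n ⊕ Fin n) (Fin n ⊕ Fin n) F) := by
  classical
  exact (OplusGrp F n).filter
    (fun w => Matrix.trace (Matrix.toBlocks₁₂ w * (Matrix.toBlocks₂₁ w)ᵀ) = 0)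

/-- The trace map `tr(x) = x + x² + ⋯ + x^{2^{r−1}}`, valued in `𝔽₂ = {0,1} ⊆ F`. -/
def trF (F : Type) [Field F] (r : ℕ) (x : F) : F := ∑ i ∈ Finset.range r, x ^ 2 ^ i

/-- The canonical additive character `λ(x) = (−1)^{tr(x)} ∈ {±1} ⊆ ℤ`. -/
noncomputable def lam (F : Type) [Field F] (r : ℕ) (x : F) : ℤ := by
  classical exact if trF F r x = 0 then 1 else -1

/-- The trace map `tr` viewed as a function into `𝔽₂ = ZMod 2`. -/
noncomputable def tr2 (F : Type) [Field F] (r : ℕ) (x : F) : ZMod 2 := by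
  classical exact if trF F r x = 0 then 0 else 1

/-- The Kloosterman sum `K(λ;a) = ∑_{α ∈ F*} λ(α + aα⁻¹)`. -/
noncomputable def Kl (F : Type) [Field F] [Fintype F] (r : ℕ) (a : F) : ℤ := by
  classical
  exact ∑ α ∈ Finset.univ.filter (fun α : F => α ≠ 0), lam F r (α + a * α⁻¹)

/-- The `m`-dimensional Kloosterman sum
`K_m(λ;a) = ∑_{α₁,…,α_m ∈ F*} λ(α₁ + ⋯ + α_m + aα₁⁻¹⋯α_m⁻¹)`;
for `m = 0` this is `K₀(λ;a) = λ(a)`. -/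
noncomputable def Klm (F : Type) [Field F] [Fintype F] (r m : ℕ) (a : F) : ℤ := by
  classical
  exact ∑ v ∈ Finset.univ.filter (fun v : Fin m → F => ∀ i, v i ≠ 0),
    lam F r ((∑ i, v i) + a * (∏ i, v i)⁻¹)

/-- The power moment `MK^h = ∑_{a ∈ F*} K(λ;a)^h`. -/
noncomputable def MK (F : Type) [Field F] [Fintype F] (r h : ℕ) : ℤ := by
  classical exact ∑ a ∈ Finset.univ.filter (fun a : F => a ≠ 0), (Kl F r a) ^ h

/-- The power moment `MK₂^h = ∑_{a ∈ F*} K₂(λ;a)^h` of 2-dimensional Kloosterman sums. -/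
noncomputable def MK2 (F : Type) [Field F] [Fintype F] (r h : ℕ) : ℤ := by
  classical exact ∑ a ∈ Finset.univ.filter (fun a : F => a ≠ 0), (Klm F r 2 a) ^ h

/-- The binary code `C(G) = {u ∈ 𝔽₂^G : ∑_{g ∈ G} u_g Tr(g) = 0 in F}`. -/
noncomputable def code (F : Type) [Field F] [Fintype F] [DecidableEq F]
    {ι : Type} [Fintype ι] [DecidableEq ι] (G : Finset (Matrix ι ι F)) :
    Finset (↥G → ZMod 2) := by
  classical
  exact Finset.univ.filter
    (fun u => ∑ g : ↥G, (u g).val • Matrix.trace (g : Matrix ι ι F) = 0)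

/-- Number of codewords of Hamming weight `j` in the code `C(G)`. -/
noncomputable def wtCount (F : Type) [Field F] [Fintype F] [DecidableEq F]
    {ι : Type} [Fintype ι] [DecidableEq ι] (G : Finset (Matrix ι ι F)) (j : ℕ) : ℕ := by
  classical
  exact ((code F G).filter
    (fun u => (Finset.univ.filter (fun g : ↥G => u g = 1)).card = j)).card

/-- `t! · S(h,t)` where `S(h,t)` is the Stirling number of the second kind,
`S(h,t) = (1/t!) ∑_{j=0}^{t} (−1)^{t−j} C(t,j) j^h`. -/
def tS (h t : ℕ) : ℤ :=
  ∑ j ∈ Finset.range (t + 1), (-1 : ℤ) ^ (t - j) * (t.choose j : ℤ) * (j : ℤ) ^ h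

/-- Binomial coefficient with integer arguments: `0` whenever `k < 0` or `k > n`. -/
def ichoose (n k : ℤ) : ℤ := if 0 ≤ k ∧ k ≤ n then (n.toNat.choose k.toNat : ℤ) else 0

section AdditiveCharacter

variable {F : Type} [Field F] {r : ℕ}

theorem trF_zero : trF F r 0 = 0 := by
  simp [trF]

theorem trF_add [CharP F 2] (x y : F) : trF F r (x + y) = trF F r x + trF F r y := by
  simp only [trF, add_pow_char_pow, Finset.sum_add_distrib]

variable [Fintype F]

theorem trF_sq (hF : Fintype.card F = 2 ^ r) (x : F) : trF F r (x ^ 2) = trF F r x := by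
  have h1 := Finset.sum_range_succ (fun i => x ^ 2 ^ i) r
  rw [Finset.sum_range_succ', ← hF, FiniteField.pow_card] at h1
  simp only [pow_zero, pow_one, add_left_inj] at h1
  rw [trF, trF, ← h1]
  refine Finset.sum_congr rfl fun i _ => ?_
  rw [← pow_mul, pow_succ']

theorem trF_eq_zero_or_one [CharP F 2] (hF : Fintype.card F = 2 ^ r) (x : F) :
    trF F r x = 0 ∨ trF F r x = 1 := by
  have h1 : trF F r x ^ 2 = trF F r x := by
    conv_rhs => rw [← trF_sq hF]
    simp only [trF, sum_pow_char, ← pow_mul, mul_comm]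
  have h2 : trF F r x * (trF F r x - 1) = 0 := by linear_combination h1
  rcases mul_eq_zero.1 h2 with h | h
  · exact Or.inl h
  · exact Or.inr (sub_eq_zero.1 h)

omit [Fintype F] in
theorem lam_eq_one_iff (x : F) : lam F r x = 1 ↔ trF F r x = 0 := by
  unfold lam
  split_ifs with h <;> simp [h]

omit [Fintype F] in
theorem lam_eq_one_or_neg_one (x : F) : lam F r x = 1 ∨ lam F r x = -1 := by
  unfold lam
  split_ifs <;> simp

omit [Fintype F] in
theorem lam_zero : lam F r 0 = 1 :=
  (lam_eq_one_iff 0).2 trF_zero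

omit [Fintype F] in
theorem lam_mul_self (x : F) : lam F r x * lam F r x = 1 := by
  rcases lam_eq_one_or_neg_one (r := r) x with h | h <;> rw [h] <;> norm_num

theorem lam_add [CharP F 2] (hF : Fintype.card F = 2 ^ r) (x y : F) :
    lam F r (x + y) = lam F r x * lam F r y := by
  rcases trF_eq_zero_or_one hF x with hx | hx <;> rcases trF_eq_zero_or_one hF y with hy | hy <;>
    simp [lam, trF_add, hx, hy, CharTwo.add_self_eq_zero]

theorem lam_sum [CharP F 2] (hF : Fintype.card F = 2 ^ r) {ι : Type*} (s : Finset ι)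
    (f : ι → F) : lam F r (∑ i ∈ s, f i) = ∏ i ∈ s, lam F r (f i) := by
  classical
  induction s using Finset.induction_on with
  | empty => simp [lam_zero]
  | insert a s ha ih => rw [Finset.sum_insert ha, Finset.prod_insert ha, lam_add hF, ih]

omit [Fintype F] in
theorem sq_add_self_eq_iff [CharP F 2] (y z : F) :
    z ^ 2 + z = y ^ 2 + y ↔ z = y ∨ z = y + 1 := by
  have h2 : (2 : F) = 0 := CharTwo.two_eq_zero
  constructor
  · intro h
    have h3 : (z - y) * (z - (y + 1)) = 0 := by
      linear_combination h + (y ^ 2 - y * z + y - z) * h2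
    rcases mul_eq_zero.1 h3 with h | h
    · exact Or.inl (sub_eq_zero.1 h)
    · exact Or.inr (sub_eq_zero.1 h)
  · rintro (rfl | rfl)
    · rfl
    · linear_combination (y + 1) * h2

variable [DecidableEq F]

theorem card_fiber_sq_add_self [CharP F 2] (y : F) :
    (Finset.univ.filter fun z : F => z ^ 2 + z = y ^ 2 + y).card = 2 := by
  have : (Finset.univ.filter fun z : F => z ^ 2 + z = y ^ 2 + y) = {y, y + 1} := by
    ext z
    simp [sq_add_self_eq_iff]
  rw [this, Finset.card_pair]
  simp

theorem card_trF_eq_zero_le (hr : 1 ≤ r) :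
    (Finset.univ.filter fun x : F => trF F r x = 0).card ≤ 2 ^ (r - 1) := by
  obtain ⟨k, rfl⟩ : ∃ k, r = k + 1 := ⟨r - 1, by omega⟩
  let p : Polynomial F := ∑ i ∈ Finset.range (k + 1), Polynomial.X ^ 2 ^ i
  have hp : p.natDegree ≤ 2 ^ k := by
    refine Polynomial.natDegree_sum_le_of_forall_le _ _ fun i hi => ?_
    rw [Polynomial.natDegree_X_pow]
    exact Nat.pow_le_pow_right (by norm_num) (Nat.lt_succ_iff.1 (Finset.mem_range.1 hi))
  have hp0 : p ≠ 0 := by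
    intro h0
    have h1 : p.coeff 1 = 0 := by rw [h0, Polynomial.coeff_zero]
    rw [Polynomial.finsetSum_coeff, Finset.sum_eq_single 0] at h1
    · simp at h1
    · intro i _ hi
      rw [Polynomial.coeff_X_pow, if_neg]
      exact (Nat.one_lt_two_pow hi).ne
    · simp
  refine (Polynomial.card_le_degree_of_subset_roots (p := p) fun x hx => ?_).trans hp
  rw [Polynomial.mem_roots hp0, Polynomial.IsRoot.def, Polynomial.eval_finsetSum]
  simpa [trF] using (Finset.mem_filter.1 hx).2

theorem image_sq_add_self [CharP F 2] (hr : 1 ≤ r) (hF : Fintype.card F = 2 ^ r) :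
    Finset.univ.image (fun y : F => y ^ 2 + y) = Finset.univ.filter fun x : F => trF F r x = 0 := by
  apply Finset.eq_of_subset_of_card_le
  · intro x hx
    obtain ⟨y, -, rfl⟩ := Finset.mem_image.1 hx
    simp [trF_add, trF_sq hF, CharTwo.add_self_eq_zero]
  · have h1 := Finset.card_eq_sum_card_image (fun y : F => y ^ 2 + y) Finset.univ
    rw [Finset.sum_congr rfl (g := fun _ => 2), Finset.sum_const, smul_eq_mul, Finset.card_univ,
      hF] at h1
    · have h2 := card_trF_eq_zero_le (F := F) hr
      obtain ⟨k, rfl⟩ : ∃ k, r = k + 1 := ⟨r - 1, by omega⟩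
      rw [pow_succ] at h1
      simp only [Nat.add_sub_cancel] at h2
      omega
    · intro x hx
      obtain ⟨y, -, rfl⟩ := Finset.mem_image.1 hx
      exact card_fiber_sq_add_self y

theorem card_sq_add_self_eq [CharP F 2] (hr : 1 ≤ r) (hF : Fintype.card F = 2 ^ r) (c : F) :
    ((Finset.univ.filter fun y : F => y ^ 2 + y = c).card : ℤ) = 1 + lam F r c := by
  have hmem := Finset.ext_iff.1 (image_sq_add_self (F := F) hr hF) c
  simp only [Finset.mem_image, Finset.mem_univ, true_and, Finset.mem_filter] at hmem
  by_cases hc : trF F r c = 0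
  · obtain ⟨y, rfl⟩ := hmem.2 hc
    rw [card_fiber_sq_add_self, (lam_eq_one_iff _).2 hc]
    norm_num
  · have h1 : lam F r c = -1 :=
      (lam_eq_one_or_neg_one c).resolve_left fun h => hc ((lam_eq_one_iff c).1 h)
    rw [h1, Finset.filter_eq_empty_iff.2 fun y _ hy => hc (hmem.1 ⟨y, hy⟩)]
    simp

theorem sum_comp_sq_add_self [CharP F 2] (hr : 1 ≤ r) (hF : Fintype.card F = 2 ^ r) (G : F → ℤ) :
    ∑ y : F, G (y ^ 2 + y) = ∑ c : F, (1 + lam F r c) * G c := by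
  rw [← Finset.sum_fiberwise (s := Finset.univ) (g := fun y : F => y ^ 2 + y)]
  refine Finset.sum_congr rfl fun c _ => ?_
  rw [← card_sq_add_self_eq hr hF c, ← nsmul_eq_mul, ← Finset.sum_const]
  exact Finset.sum_congr rfl fun y hy => by rw [(Finset.mem_filter.1 hy).2]

theorem sum_lam [CharP F 2] (hr : 1 ≤ r) (hF : Fintype.card F = 2 ^ r) :
    ∑ x : F, lam F r x = 0 := by
  have h := sum_comp_sq_add_self hr hF fun _ => 1
  simp only [mul_one, Finset.sum_add_distrib] at h
  linarith

theorem sum_lam_mul [CharP F 2] (hr : 1 ≤ r) (hF : Fintype.card F = 2 ^ r) (a : F) :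
    ∑ x : F, lam F r (a * x) = if a = 0 then (2 : ℤ) ^ r else 0 := by
  split_ifs with ha
  · simp [ha, lam_zero, hF]
  · rw [← sum_lam hr hF]
    exact Fintype.sum_equiv (Equiv.mulLeft₀ a ha) _ _ fun x => rfl

theorem sum_units_eq (f : F → ℤ) : ∑ u : Fˣ, f u = ∑ x : F, if x = 0 then 0 else f x := by
  rw [Finset.sum_ite, Finset.sum_const_zero, zero_add]
  refine Finset.sum_bij (fun u _ => (u : F)) (by simp) (fun u _ v _ h => Units.ext h)
    (fun x hx => ⟨Units.mk0 x (Finset.mem_filter.1 hx).2, by simp⟩) fun _ _ => rfl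

theorem sum_eq_zero_add_sum_units (f : F → ℤ) : ∑ x : F, f x = f 0 + ∑ u : Fˣ, f u := by
  rw [sum_units_eq, ← Finset.add_sum_erase _ _ (Finset.mem_univ (0 : F)),
    ← Finset.add_sum_erase _ (fun x : F => if x = 0 then 0 else f x) (Finset.mem_univ (0 : F))]
  simp only [if_true, zero_add]
  congr 1
  exact Finset.sum_congr rfl fun x hx => by rw [if_neg (Finset.ne_of_mem_erase hx)]

theorem sum_units_lam_mul [CharP F 2] (hr : 1 ≤ r) (hF : Fintype.card F = 2 ^ r) {a : F}
    (ha : a ≠ 0) : ∑ u : Fˣ, lam F r (a * u) = -1 := by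
  have h := sum_eq_zero_add_sum_units fun x : F => lam F r (a * x)
  rw [sum_lam_mul hr hF, if_neg ha, mul_zero, lam_zero] at h
  linarith

theorem Kl_eq_sum_units (a : F) : Kl F r a = ∑ u : Fˣ, lam F r (u + a * (u : F)⁻¹) := by
  rw [sum_units_eq (fun x : F => lam F r (x + a * x⁻¹)), Finset.sum_ite, Finset.sum_const_zero,
    zero_add, Kl]
  congr

theorem sum_units_Kl_mul [CharP F 2] (hr : 1 ≤ r) (hF : Fintype.card F = 2 ^ r) {a : F}
    (ha : a ≠ 0) : ∑ u : Fˣ, Kl F r (a * u) = 1 := by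
  simp only [Kl_eq_sum_units]
  rw [Finset.sum_comm]
  have h1 : ∀ v : Fˣ, ∑ u : Fˣ, lam F r (v + a * u * (v : F)⁻¹) = - lam F r (1 * (v : F)) := by
    intro v
    simp only [lam_add hF]
    rw [← Finset.mul_sum]
    have h2 := sum_units_lam_mul hr hF (a := a * (v : F)⁻¹)
      (mul_ne_zero ha (inv_ne_zero v.ne_zero))
    simp only [mul_right_comm a _ (_ : F)⁻¹, h2, one_mul, mul_neg, mul_one]
  rw [Finset.sum_congr rfl fun v _ => h1 v, Finset.sum_neg_distrib,
    sum_units_lam_mul hr hF one_ne_zero, neg_neg]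

theorem sum_units_Kl_mul_inv [CharP F 2] (hr : 1 ≤ r) (hF : Fintype.card F = 2 ^ r) {a : F}
    (ha : a ≠ 0) : ∑ u : Fˣ, Kl F r (a * (u : F)⁻¹) = 1 := by
  rw [← sum_units_Kl_mul hr hF ha]
  exact Fintype.sum_equiv (Equiv.inv Fˣ) _ _ fun u => by simp

/-- Carlitz's relation, in the form `K(λ;a)² = q + K₂(λ;a)`. -/
theorem Kl_sq [CharP F 2] (hr : 1 ≤ r) (hF : Fintype.card F = 2 ^ r) {a : F} (ha : a ≠ 0) :
    Kl F r a ^ 2 = 2 ^ r + ∑ c : Fˣ, lam F r c * Kl F r (a * (c : F)⁻¹) := by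
  have h2 : (2 : F) = 0 := CharTwo.two_eq_zero
  let G : F → ℤ := fun c => if c = 0 then 0 else Kl F r (a * c⁻¹)
  have hG : ∀ f : F → ℤ, ∑ c : F, f c * G c = ∑ c : Fˣ, f c * Kl F r (a * (c : F)⁻¹) := by
    intro f
    rw [sum_units_eq fun c : F => f c * Kl F r (a * c⁻¹)]
    exact Finset.sum_congr rfl fun c _ => by simp only [G]; split_ifs <;> simp
  have hdiag : ∑ u : Fˣ, lam F r (u + a * (u : F)⁻¹) * lam F r (u + a * (u : F)⁻¹) = 2 ^ r - 1 := by
    have := sum_eq_zero_add_sum_units (F := F) fun _ => 1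
    simp only [Finset.sum_const, Finset.card_univ, hF, nsmul_eq_mul, mul_one] at this
    push_cast at this
    simp only [lam_mul_self, Finset.sum_const, Finset.card_univ, nsmul_eq_mul, mul_one]
    linarith
  have hoff : ∑ u : Fˣ, ∑ v ∈ Finset.univ.erase u,
      lam F r (u + a * (u : F)⁻¹) * lam F r (v + a * (v : F)⁻¹) = ∑ y : F, G (y ^ 2 + y) := by
    have hR : ∑ y : F, G (y ^ 2 + y) = ∑ y ∈ Finset.univ.filter (fun y : F => y ^ 2 + y ≠ 0),
        ∑ s : Fˣ, lam F r (s + a * (y ^ 2 + y)⁻¹ * (s : F)⁻¹) := by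
      rw [Finset.sum_filter]
      refine Finset.sum_congr rfl fun y _ => ?_
      simp only [G, Kl_eq_sum_units, ne_eq, ite_not]
    rw [hR, Finset.sum_sigma', Finset.sum_sigma']
    have hne : ∀ p ∈ Finset.univ.sigma fun u : Fˣ => Finset.univ.erase u,
        (p.1 : F) + p.2 ≠ 0 := by
      rintro ⟨u, v⟩ hp h
      simp only [Finset.mem_sigma, Finset.mem_univ, Finset.mem_erase, true_and, and_true] at hp
      exact hp (Units.ext (CharTwo.add_eq_zero.1 h).symm)
    have hne' : ∀ p ∈ (Finset.univ.filter (fun y : F => y ^ 2 + y ≠ 0)).sigma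
        fun _ => (Finset.univ : Finset Fˣ), p.1 ≠ 0 ∧ p.1 + 1 ≠ 0 := by
      rintro ⟨y, s⟩ hp
      simp only [Finset.mem_sigma, Finset.mem_univ, Finset.mem_filter, true_and, and_true] at hp
      rw [sq, ← mul_add_one] at hp
      exact mul_ne_zero_iff.1 hp
    refine Finset.sum_bij'
      (fun p hp => ⟨p.1 / (p.1 + p.2), Units.mk0 _ (hne p hp)⟩)
      (fun p hp => ⟨Units.mk0 p.1 (hne' p hp).1 * p.2, Units.mk0 _ (hne' p hp).2 * p.2⟩)
      ?_ ?_ ?_ ?_ ?_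
    · rintro ⟨u, v⟩ hp
      have h0 := hne _ hp
      simp only [Finset.mem_sigma, Finset.mem_univ, Finset.mem_filter, true_and, and_true]
      have : ((u : F) / (u + v)) ^ 2 + u / (u + v) = u * v / (u + v) ^ 2 := by
        field_simp
        linear_combination (u : F) * h2
      rw [this]
      exact div_ne_zero (mul_ne_zero u.ne_zero v.ne_zero) (pow_ne_zero _ h0)
    · rintro ⟨y, s⟩ hp
      simp only [Finset.mem_sigma, Finset.mem_univ, Finset.mem_erase, true_and, and_true, ne_eq,
        Units.ext_iff, Units.val_mul, Units.val_mk0]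
      intro h
      exact s.ne_zero (by linear_combination h)
    · rintro ⟨u, v⟩ hp
      have h0 := hne _ hp
      simp only [Sigma.mk.injEq, heq_eq_eq, Units.ext_iff, Units.val_mul, Units.val_mk0]
      constructor
      · field_simp
      · field_simp
        linear_combination (u : F) * h2
    · rintro ⟨y, s⟩ hp
      have h0 : y * s + (y + 1) * s = s := by linear_combination y * s * h2
      simp only [Sigma.mk.injEq, heq_eq_eq, Units.ext_iff, Units.val_mul, Units.val_mk0, h0,
        and_true]
      exact mul_div_cancel_right₀ y s.ne_zero
    · rintro ⟨u, v⟩ hp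
      have h0 := hne _ hp
      rw [← lam_add hF]
      simp only [Units.val_mk0]
      congr 1
      have : ((u : F) / (u + v)) ^ 2 + u / (u + v) = u * v / (u + v) ^ 2 := by
        field_simp
        linear_combination (u : F) * h2
      rw [this]
      field_simp
      ring
  have hK : Kl F r a ^ 2 = (2 ^ r - 1) + ∑ y : F, G (y ^ 2 + y) := by
    rw [← hdiag, ← hoff, ← Finset.sum_add_distrib, sq, Kl_eq_sum_units, Finset.sum_mul_sum]
    exact Finset.sum_congr rfl fun u _ => (Finset.add_sum_erase _ _ (Finset.mem_univ u)).symm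
  rw [hK, sum_comp_sq_add_self hr hF, hG]
  simp only [add_mul, one_mul, Finset.sum_add_distrib, sum_units_Kl_mul_inv hr hF ha]
  ring

end AdditiveCharacter

section SpecialLinear

variable {F : Type} [Field F] [Fintype F] [DecidableEq F] {r : ℕ}

theorem sum_units_add_inv [CharP F 2] (hr : 1 ≤ r) (hF : Fintype.card F = 2 ^ r) (f : F → ℤ) :
    ∑ a : Fˣ, f (a + (a : F)⁻¹) = ∑ t : F, f t + ∑ c : Fˣ, lam F r c * f (c : F)⁻¹ := by
  have h2 : (2 : F) = 0 := CharTwo.two_eq_zero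
  let G : F → ℤ := fun c => if c = 0 then 0 else f c⁻¹
  have hG : ∀ k : F → ℤ, ∑ c : F, k c * G c = ∑ c : Fˣ, k c * f (c : F)⁻¹ := by
    intro k
    rw [sum_units_eq fun c : F => k c * f c⁻¹]
    exact Finset.sum_congr rfl fun c _ => by simp only [G]; split_ifs <;> simp
  have hinv : ∑ c : Fˣ, f (c : F)⁻¹ = ∑ c : Fˣ, f c :=
    Fintype.sum_equiv (Equiv.inv Fˣ) _ _ fun u => by simp
  have hoff : ∑ a ∈ Finset.univ.erase (1 : Fˣ), f (a + (a : F)⁻¹) = ∑ y : F, G (y ^ 2 + y) := by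
    have hR : ∑ y : F, G (y ^ 2 + y) = ∑ y ∈ Finset.univ.filter (fun y : F => y ^ 2 + y ≠ 0),
        f (y ^ 2 + y)⁻¹ := by
      rw [Finset.sum_filter]
      refine Finset.sum_congr rfl fun y _ => ?_
      simp only [G, ne_eq, ite_not]
    rw [hR]
    have hne : ∀ a ∈ Finset.univ.erase (1 : Fˣ), (a : F) + 1 ≠ 0 := fun a ha h =>
      Finset.ne_of_mem_erase ha (Units.ext (CharTwo.add_eq_zero.1 h))
    have hne' : ∀ y ∈ Finset.univ.filter (fun y : F => y ^ 2 + y ≠ 0), y ≠ 0 ∧ y + 1 ≠ 0 := by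
      intro y hy
      have hy := (Finset.mem_filter.1 hy).2
      rw [sq, ← mul_add_one] at hy
      exact mul_ne_zero_iff.1 hy
    have hval : ∀ a : Fˣ, (a : F) + 1 ≠ 0 →
        ((a : F) / (a + 1)) ^ 2 + a / (a + 1) = a / (a + 1) ^ 2 := by
      intro a h0
      field_simp
      linear_combination (a : F) * h2
    refine Finset.sum_bij' (fun a _ => (a : F) / (a + 1))
      (fun y hy => Units.mk0 (y / (y + 1)) (div_ne_zero (hne' y hy).1 (hne' y hy).2)) ?_ ?_ ?_ ?_ ?_
    · intro a ha
      have h0 := hne a ha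
      simp only [Finset.mem_univ, Finset.mem_filter, true_and, hval a h0]
      exact div_ne_zero a.ne_zero (pow_ne_zero _ h0)
    · intro y hy
      have h0 := (hne' y hy).2
      simp only [Finset.mem_univ, Finset.mem_erase, and_true, ne_eq, Units.ext_iff, Units.val_mk0,
        Units.val_one]
      intro h
      rw [div_eq_one_iff_eq h0] at h
      simp at h
    · intro a ha
      have h0 := hne a ha
      have h1 : (a : F) / (a + 1) + 1 = 1 / (a + 1) := by
        field_simp
        linear_combination (a : F) * h2
      rw [Units.ext_iff, Units.val_mk0, h1]
      field_simp
    · intro y hy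
      have h0 := (hne' y hy).2
      have h1 : y / (y + 1) + 1 = 1 / (y + 1) := by
        field_simp
        linear_combination y * h2
      rw [Units.val_mk0, h1]
      field_simp
    · intro a ha
      have h0 := hne a ha
      have h1 := a.ne_zero
      rw [hval a h0]
      congr 1
      field_simp
      linear_combination -(a : F) * h2
  rw [← Finset.add_sum_erase _ _ (Finset.mem_univ (1 : Fˣ)), hoff, sum_comp_sq_add_self hr hF, hG,
    sum_eq_zero_add_sum_units f]
  simp only [add_mul, one_mul, Finset.sum_add_distrib, hinv, Units.val_one, inv_one,
    CharTwo.add_self_eq_zero]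
  ring

theorem card_units_eq (hF : Fintype.card F = 2 ^ r) : (Fintype.card Fˣ : ℤ) = 2 ^ r - 1 := by
  have := sum_eq_zero_add_sum_units (F := F) fun _ => 1
  simp only [Finset.sum_const, Finset.card_univ, hF, nsmul_eq_mul, mul_one] at this
  push_cast at this
  linarith

theorem card_mul_eq (hF : Fintype.card F = 2 ^ r) (m : F) :
    ∑ b : F, ∑ c : F, (if b * c = m then 1 else 0 : ℤ) =
      (2 ^ r - 1) + if m = 0 then (2 : ℤ) ^ r else 0 := by
  have h1 : ∀ b : Fˣ, ∑ c : F, (if (b : F) * c = m then 1 else 0 : ℤ) = 1 := by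
    intro b
    simp only [← eq_inv_mul_iff_mul_eq₀ b.ne_zero, Finset.sum_ite_eq', Finset.mem_univ, if_true]
  rw [sum_eq_zero_add_sum_units, Finset.sum_congr rfl fun b _ => h1 b]
  simp only [zero_mul, Finset.sum_const, Finset.card_univ, nsmul_eq_mul, mul_one,
    card_units_eq hF, hF, eq_comm (a := (0 : F))]
  split_ifs <;> simp [add_comm]

theorem sum_specialLinearGroup_two (f : F → F → F → F → ℤ) :
    ∑ g : SpecialLinearGroup (Fin 2) F, f (g 0 0) (g 0 1) (g 1 0) (g 1 1) =
      ∑ a : F, ∑ d : F, ∑ b : F, ∑ c : F, if b * c = a * d - 1 then f a b c d else 0 := by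
  simp only [← Fintype.sum_prod_type']
  rw [← Finset.sum_filter]
  refine Finset.sum_bij' (fun g _ => (g 0 0, g 1 1, g 0 1, g 1 0))
    (fun p hp => ⟨!![p.1, p.2.2.1; p.2.2.2, p.2.1], ?_⟩) ?_ ?_ ?_ ?_ ?_
  · have := (Finset.mem_filter.1 hp).2
    rw [Matrix.det_fin_two_of]
    linear_combination -this
  · intro g _
    have := g.det_coe
    rw [Matrix.det_fin_two] at this
    simp only [Finset.mem_filter, Finset.mem_univ, true_and]
    linear_combination -this
  · exact fun _ _ => Finset.mem_univ _
  · intro g _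
    ext i j
    fin_cases i <;> fin_cases j <;> rfl
  · intro p _
    rfl
  · intro g _
    rfl

/-- The distribution of the trace on `SL(2,q)`. -/
theorem sum_trace_specialLinearGroup [CharP F 2] (hr : 1 ≤ r) (hF : Fintype.card F = 2 ^ r)
    (f : F → ℤ) :
    ∑ g : SpecialLinearGroup (Fin 2) F, f (Matrix.trace (g : Matrix (Fin 2) (Fin 2) F)) =
      (2 ^ r) ^ 2 * ∑ t : F, f t + 2 ^ r * ∑ c : Fˣ, lam F r c * f (c : F)⁻¹ := by
  simp only [Matrix.trace_fin_two]
  rw [sum_specialLinearGroup_two fun a _ _ d => f (a + d)]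
  have h1 : ∀ a d : F, (∑ b : F, ∑ c : F, if b * c = a * d - 1 then f (a + d) else 0) =
      (2 ^ r - 1) * f (a + d) + if a * d = 1 then 2 ^ r * f (a + d) else 0 := by
    intro a d
    have := congrArg (· * f (a + d)) (card_mul_eq hF (a * d - 1))
    simp only [Finset.sum_mul, ite_mul, one_mul, zero_mul, add_mul, sub_eq_zero] at this
    rw [this]
  have h3 : ∑ a : F, ∑ d : F, f (a + d) = 2 ^ r * ∑ t : F, f t := by
    have h5 : ∀ a : F, ∑ d : F, f (a + d) = ∑ t : F, f t := fun a =>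
      Fintype.sum_equiv (Equiv.addLeft a) _ _ fun d => rfl
    simp [h5, hF]
  have h4 : ∑ a : F, ∑ d : F, (if a * d = 1 then 2 ^ r * f (a + d) else 0) =
      2 ^ r * ∑ a : Fˣ, f (a + (a : F)⁻¹) := by
    have h5 : ∀ a : Fˣ, ∑ d : F, (if (a : F) * d = 1 then 2 ^ r * f (a + d) else 0) =
        2 ^ r * f (a + (a : F)⁻¹) := by
      intro a
      simp only [← eq_inv_mul_iff_mul_eq₀ a.ne_zero, Finset.sum_ite_eq', Finset.mem_univ, if_true,
        mul_one]
    rw [sum_eq_zero_add_sum_units, Finset.sum_congr rfl fun a _ => h5 a, Finset.mul_sum]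
    simp
  simp only [h1, Finset.sum_add_distrib, ← Finset.mul_sum]
  rw [h3, h4, sum_units_add_inv hr hF]
  ring

theorem card_specialLinearGroup_two [CharP F 2] (hr : 1 ≤ r) (hF : Fintype.card F = 2 ^ r) :
    (Fintype.card (SpecialLinearGroup (Fin 2) F) : ℤ) = 2 ^ r * ((2 ^ r) ^ 2 - 1) := by
  have h1 := sum_trace_specialLinearGroup hr hF fun _ => 1
  have h2 := sum_units_lam_mul (F := F) hr hF one_ne_zero
  simp only [one_mul] at h2
  simp only [Finset.sum_const, Finset.card_univ, nsmul_eq_mul, mul_one, h2, hF] at h1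
  push_cast at h1
  rw [h1]
  ring

theorem sum_lam_trace_mul_trace [CharP F 2] (hr : 1 ≤ r) (hF : Fintype.card F = 2 ^ r) {a : F}
    (ha : a ≠ 0) :
    ∑ g : SpecialLinearGroup (Fin 2) F, ∑ k : SpecialLinearGroup (Fin 2) F,
      lam F r (a * (Matrix.trace (g : Matrix (Fin 2) (Fin 2) F) *
        Matrix.trace (k : Matrix (Fin 2) (Fin 2) F))) =
      (2 ^ r) ^ 2 * (Kl F r a ^ 2 + (2 ^ r) ^ 3 - 2 ^ r) := by
  let φ : F → ℤ := fun s => ∑ k : SpecialLinearGroup (Fin 2) F,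
    lam F r (a * (s * Matrix.trace (k : Matrix (Fin 2) (Fin 2) F)))
  have h0 : φ 0 = 2 ^ r * ((2 ^ r) ^ 2 - 1) := by
    simp [φ, lam_zero, card_specialLinearGroup_two hr hF]
  have h1 : ∀ s : F, s ≠ 0 → φ s = 2 ^ r * Kl F r (a * s) := by
    intro s hs
    have h2 := sum_lam_mul hr hF (a * s)
    rw [if_neg (mul_ne_zero ha hs)] at h2
    simp only [φ, ← mul_assoc]
    rw [sum_trace_specialLinearGroup hr hF fun t => lam F r (a * s * t), h2, Kl_eq_sum_units]
    simp only [lam_add hF]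
    ring
  have h2 : ∑ s : Fˣ, φ s = 2 ^ r := by
    rw [Finset.sum_congr rfl fun (s : Fˣ) _ => h1 (s : F) s.ne_zero, ← Finset.mul_sum,
      sum_units_Kl_mul hr hF ha, mul_one]
  have h3 : ∑ c : Fˣ, lam F r c * φ (c : F)⁻¹ = 2 ^ r * (Kl F r a ^ 2 - 2 ^ r) := by
    rw [Kl_sq hr hF ha, add_sub_cancel_left, Finset.mul_sum]
    refine Finset.sum_congr rfl fun c _ => ?_
    rw [h1 _ (inv_ne_zero c.ne_zero)]
    ring
  have h4 := sum_trace_specialLinearGroup hr hF φ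
  rw [h3, sum_eq_zero_add_sum_units φ, h0, h2] at h4
  rw [h4]
  ring

end SpecialLinear

section PowerMoments

theorem tS_eq_fwdDiff (h t : ℕ) : tS h t = (fwdDiff 1)^[t] (fun x : ℤ => x ^ h) 0 := by
  simp [tS, fwdDiff_iter_eq_sum_shift]

theorem sum_tS_mul_choose (h w : ℕ) :
    ∑ t ∈ Finset.range (h + 1), tS h t * (w.choose t : ℤ) = (w : ℤ) ^ h := by
  have h1 := shift_eq_sum_fwdDiff_iter (1 : ℤ) (fun x : ℤ => x ^ h) w 0
  simp only [← tS_eq_fwdDiff, zero_add, nsmul_eq_mul, mul_one] at h1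
  have hz : ∀ t, h < t → tS h t = 0 := fun t ht => by
    rw [tS_eq_fwdDiff, fwdDiff_iter_pow_eq_zero_of_lt ht, Pi.zero_apply]
  rw [h1]
  trans ∑ t ∈ Finset.range (h + w + 1), (w.choose t : ℤ) * tS h t
  · rw [← Finset.sum_subset (Finset.range_mono (by omega : h + 1 ≤ h + w + 1))]
    · exact Finset.sum_congr rfl fun t _ => mul_comm _ _
    · intro t _ ht
      rw [hz t (by simpa [Nat.lt_succ_iff] using ht), mul_zero]
  · symm
    apply Finset.sum_subset (Finset.range_mono (by omega : w + 1 ≤ h + w + 1))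
    intro t _ ht
    rw [Nat.choose_eq_zero_of_lt (by simpa [Nat.lt_succ_iff] using ht), Nat.cast_zero, zero_mul]

theorem ichoose_sub_sub {N j t : ℕ} (hjN : j ≤ N) (hjt : j ≤ t) :
    ichoose ((N : ℤ) - j) ((N : ℤ) - t) = ((N - j).choose (t - j) : ℤ) := by
  unfold ichoose
  by_cases ht : t ≤ N
  · rw [if_pos ⟨by omega, by omega⟩, ← Nat.choose_symm (by omega : t - j ≤ N - j)]
    congr 2 <;> omega
  · rw [if_neg (by omega), Nat.choose_eq_zero_of_lt (by omega), Nat.cast_zero]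

variable {ι : Type*} [Fintype ι]

theorem two_pow_mul_choose_card_neg_one [DecidableEq ι] (s : ι → ℤ) (hs : ∀ i, s i = 1 ∨ s i = -1)
    (t : ℕ) :
    2 ^ t * ((Finset.univ.filter fun i => s i = -1).card.choose t : ℤ) =
      ∑ j ∈ Finset.range (t + 1), (-1) ^ j *
        (∑ U ∈ Finset.powersetCard j Finset.univ, ∏ i ∈ U, s i) *
        ((Fintype.card ι - j).choose (t - j) : ℤ) := by
  set w := (Finset.univ.filter fun i => s i = -1).card with hw
  open Polynomial in
  have h1 : (1 + C 2 * X : ℤ[X]) ^ w = ∏ i, (C (-s i) * X + (1 + X)) := by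
    rw [hw, ← Finset.prod_const, Finset.prod_filter]
    refine Finset.prod_congr rfl fun i _ => ?_
    rcases hs i with h | h <;> rw [h]
    · rw [if_neg (by norm_num)]
      simp
    · rw [if_pos rfl]
      simp only [neg_neg, map_one, map_ofNat]
      ring
  open Polynomial in
  have h2 : ∏ i, (C (-s i) * X + (1 + X) : ℤ[X]) = ∑ U ∈ (Finset.univ : Finset ι).powerset,
      C ((-1) ^ U.card * ∏ i ∈ U, s i) * (X ^ U.card * (1 + X) ^ (Fintype.card ι - U.card)) := by
    rw [Finset.prod_add]
    refine Finset.sum_congr rfl fun U _ => ?_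
    rw [Finset.prod_mul_distrib, Finset.prod_const, Finset.prod_const, ← map_prod,
      Finset.prod_neg, Finset.card_sdiff_of_subset (Finset.subset_univ U), Finset.card_univ,
      mul_assoc]
  have h3 : ((1 + Polynomial.C 2 * Polynomial.X : Polynomial ℤ) ^ w).coeff t =
      2 ^ t * (w.choose t : ℤ) := by
    have : (1 + Polynomial.C 2 * Polynomial.X : Polynomial ℤ) ^ w =
        ((1 + Polynomial.X) ^ w : Polynomial ℤ).comp (Polynomial.C 2 * Polynomial.X) := by
      simp
    rw [this, Polynomial.comp_C_mul_X_coeff, Polynomial.coeff_one_add_X_pow, mul_comm]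
  have h4 : ∀ k m : ℕ, ((Polynomial.X : Polynomial ℤ) ^ k * (1 + Polynomial.X) ^ m).coeff t =
      if k ≤ t then (m.choose (t - k) : ℤ) else 0 := by
    intro k m
    rw [Polynomial.coeff_X_pow_mul', Polynomial.coeff_one_add_X_pow]
  rw [← h3, h1, h2, Polynomial.finsetSum_coeff]
  simp only [Polynomial.coeff_C_mul, h4]
  simp only [Finset.powersetCard_eq_filter, Finset.sum_filter, Finset.mul_sum, Finset.sum_mul]
  rw [Finset.sum_comm]
  refine Finset.sum_congr rfl fun U _ => ?_
  simp only [mul_ite, ite_mul, mul_zero, zero_mul, Finset.sum_ite_eq, Finset.mem_range,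
    Nat.lt_succ_iff]

theorem two_pow_mul_card_neg_one_pow [DecidableEq ι] (s : ι → ℤ) (hs : ∀ i, s i = 1 ∨ s i = -1)
    (h : ℕ) :
    2 ^ h * ((Finset.univ.filter fun i => s i = -1).card : ℤ) ^ h =
      ∑ j ∈ Finset.range (min (Fintype.card ι) h + 1), (-1) ^ j *
        (∑ U ∈ Finset.powersetCard j Finset.univ, ∏ i ∈ U, s i) *
        ∑ t ∈ Finset.Icc j h, tS h t * 2 ^ (h - t) *
          ichoose ((Fintype.card ι : ℤ) - j) ((Fintype.card ι : ℤ) - t) := by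
  set w := (Finset.univ.filter fun i => s i = -1).card with hw
  rw [← sum_tS_mul_choose, Finset.mul_sum]
  trans ∑ t ∈ Finset.range (h + 1), ∑ j ∈ Finset.range (t + 1), tS h t * 2 ^ (h - t) * ((-1) ^ j *
        (∑ U ∈ Finset.powersetCard j Finset.univ, ∏ i ∈ U, s i) *
        ((Fintype.card ι - j).choose (t - j) : ℤ))
  · refine Finset.sum_congr rfl fun t ht => ?_
    rw [← Finset.mul_sum, ← two_pow_mul_choose_card_neg_one s hs, ← hw,
      ← Nat.sub_add_cancel (Nat.lt_succ_iff.1 (Finset.mem_range.1 ht)), pow_add,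
      Nat.add_sub_cancel]
    ring
  · rw [Finset.sum_comm' (t' := Finset.range (h + 1)) (s' := fun j => Finset.Icc j h)
      (by intro t j; simp only [Finset.mem_range, Finset.mem_Icc]; omega)]
    symm
    trans ∑ j ∈ Finset.range (min (Fintype.card ι) h + 1), ∑ t ∈ Finset.Icc j h,
        tS h t * 2 ^ (h - t) * ((-1) ^ j *
        (∑ U ∈ Finset.powersetCard j Finset.univ, ∏ i ∈ U, s i) *
        ((Fintype.card ι - j).choose (t - j) : ℤ))
    · refine Finset.sum_congr rfl fun j hj => ?_
      rw [Finset.mul_sum]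
      refine Finset.sum_congr rfl fun t ht => ?_
      rw [ichoose_sub_sub (by rw [Finset.mem_range] at hj; omega) (Finset.mem_Icc.1 ht).1]
      ring
    · apply Finset.sum_subset (Finset.range_mono (by omega))
      intro j hj hj'
      rw [Finset.mem_range] at hj hj'
      refine Finset.sum_eq_zero fun t _ => ?_
      rw [Finset.powersetCard_eq_empty.2 (by rw [Finset.card_univ]; omega)]
      simp

end PowerMoments

section Code

variable {F : Type} [Field F] [Fintype F] [DecidableEq F] {r : ℕ}

theorem wtCount_eq_card_subsets {ι : Type} [Fintype ι] [DecidableEq ι] (G : Finset (Matrix ι ι F))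
    (j : ℕ) :
    wtCount F G j = ((Finset.powersetCard j (Finset.univ : Finset G)).filter
      fun U : Finset G => ∑ g ∈ U, Matrix.trace (g : Matrix ι ι F) = 0).card := by
  have hu : ∀ x : ZMod 2, x = 0 ∨ x = 1 := by decide
  have key : ∀ u : G → ZMod 2, ∑ g : G, (u g).val • Matrix.trace (g : Matrix ι ι F) =
      ∑ g ∈ Finset.univ.filter (fun g : G => u g = 1), Matrix.trace (g : Matrix ι ι F) := by
    intro u
    rw [Finset.sum_filter]
    refine Finset.sum_congr rfl fun g _ => ?_
    rcases hu (u g) with h | h <;> simp [h, ZMod.val_one]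
  unfold wtCount code
  refine Finset.card_bij' (fun u _ => Finset.univ.filter fun g : G => u g = 1)
    (fun U _ g => if g ∈ U then 1 else 0) ?_ ?_ ?_ ?_
  · intro u hu'
    simp only [Finset.mem_filter, Finset.mem_univ, true_and, key] at hu'
    simp only [Finset.mem_filter, Finset.mem_powersetCard]
    exact ⟨⟨Finset.subset_univ _, by convert hu'.2⟩, by convert hu'.1⟩
  · intro U hU
    simp only [Finset.mem_filter, Finset.mem_powersetCard] at hU
    simp only [Finset.mem_filter, Finset.mem_univ, true_and, key]
    have : (Finset.univ.filter fun g : G => (if g ∈ U then (1 : ZMod 2) else 0) = 1) = U := by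
      ext g
      simp
    constructor
    · convert hU.2
    · convert hU.1.2
  · intro u _
    funext g
    rcases hu (u g) with h | h <;> simp [h]
  · intro U _
    ext g
    simp

theorem card_mul_wtCount [CharP F 2] (hr : 1 ≤ r) (hF : Fintype.card F = 2 ^ r)
    {ι : Type} [Fintype ι] [DecidableEq ι] (G : Finset (Matrix ι ι F)) (j : ℕ) :
    2 ^ r * (wtCount F G j : ℤ) = ∑ a : F, ∑ U ∈ Finset.powersetCard j (Finset.univ : Finset G),
      ∏ g ∈ U, lam F r (a * Matrix.trace (g : Matrix ι ι F)) := by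
  rw [Finset.sum_comm, wtCount_eq_card_subsets, ← nsmul_eq_mul', ← Finset.sum_const,
    Finset.sum_filter]
  refine Finset.sum_congr rfl fun U _ => ?_
  simp only [← lam_sum hF, ← Finset.mul_sum, ← sum_lam_mul hr hF, mul_comm]

/-- The Pless power moment identity for `C(G)`, with the weights of the dual code indexed by `F`. -/
theorem two_pow_mul_sum_weight_pow [CharP F 2] (hr : 1 ≤ r) (hF : Fintype.card F = 2 ^ r)
    {ι : Type} [Fintype ι] [DecidableEq ι] (G : Finset (Matrix ι ι F)) (h : ℕ) :
    2 ^ h * ∑ a : F, ((Finset.univ.filter fun g : G =>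
        lam F r (a * Matrix.trace (g : Matrix ι ι F)) = -1).card : ℤ) ^ h =
      2 ^ r * ∑ j ∈ Finset.range (min G.card h + 1), (-1) ^ j * (wtCount F G j : ℤ) *
        ∑ t ∈ Finset.Icc j h, tS h t * 2 ^ (h - t) *
          ichoose ((G.card : ℤ) - j) ((G.card : ℤ) - t) := by
  rw [Finset.mul_sum, Finset.sum_congr rfl fun a _ => two_pow_mul_card_neg_one_pow
    (fun g : G => lam F r (a * Matrix.trace (g : Matrix ι ι F)))
    (fun _ => lam_eq_one_or_neg_one _) h, Finset.sum_comm, Finset.mul_sum, Fintype.card_coe]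
  refine Finset.sum_congr rfl fun j _ => ?_
  rw [← Finset.sum_mul, ← Finset.mul_sum, ← card_mul_wtCount hr hF]
  ring

theorem two_mul_card_eq_neg_one {ι : Type*} [Fintype ι] (s : ι → ℤ)
    (hs : ∀ i, s i = 1 ∨ s i = -1) :
    2 * ((Finset.univ.filter fun i => s i = -1).card : ℤ) = Fintype.card ι - ∑ i, s i := by
  rw [← Finset.card_univ, Finset.cast_card, Finset.cast_card, Finset.sum_filter, Finset.mul_sum,
    ← Finset.sum_sub_distrib]
  refine Finset.sum_congr rfl fun i _ => ?_
  rcases hs i with h | h <;> rw [h] <;> norm_num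

end Code

section OrthogonalGroup

variable {F : Type} [Field F]

/-- The matrix of `X ↦ g X ᵗk` on `2 × 2` matrices, where `x` stands for
`X = [[x₁, x₂], [x₄, x₃]]`, whose determinant is `θ⁺(x)` in characteristic two. -/
def tensorMatrix (g k : Matrix (Fin 2) (Fin 2) F) : Matrix (Fin 2 ⊕ Fin 2) (Fin 2 ⊕ Fin 2) F :=
  Matrix.of fun a b =>
    g (Sum.elim (fun _ => 0) (fun _ => 1) a) (Sum.elim (fun _ => 0) (fun _ => 1) b) *
      k (Sum.elim id (Equiv.swap 0 1) a) (Sum.elim id (Equiv.swap 0 1) b)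

theorem tensorMatrix_mul (g k g' k' : Matrix (Fin 2) (Fin 2) F) :
    tensorMatrix g k * tensorMatrix g' k' = tensorMatrix (g * g') (k * k') := by
  ext a b
  simp only [tensorMatrix, Matrix.mul_apply, Fintype.sum_sum_type, Fin.sum_univ_two,
    Matrix.of_apply, Sum.elim_inl, Sum.elim_inr, id_eq, Equiv.swap_apply_left,
    Equiv.swap_apply_right]
  ring

theorem tensorMatrix_one : tensorMatrix (1 : Matrix (Fin 2) (Fin 2) F) 1 = 1 := by
  ext a b
  rcases a with a | a <;> rcases b with b | b <;> fin_cases a <;> fin_cases b <;>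
    simp [tensorMatrix, Matrix.one_apply]

theorem trace_tensorMatrix (g k : Matrix (Fin 2) (Fin 2) F) :
    Matrix.trace (tensorMatrix g k) = Matrix.trace g * Matrix.trace k := by
  simp only [Matrix.trace, Matrix.diag_apply, tensorMatrix, Fintype.sum_sum_type,
    Fin.sum_univ_two, Matrix.of_apply, Sum.elim_inl, Sum.elim_inr, id_eq, Equiv.swap_apply_left,
    Equiv.swap_apply_right]
  ring

theorem thetaPlus_two (x : Fin 2 ⊕ Fin 2 → F) :
    thetaPlus F 2 x = x (Sum.inl 0) * x (Sum.inr 0) + x (Sum.inl 1) * x (Sum.inr 1) := by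
  simp [thetaPlus]

theorem thetaPlus_tensorMatrix [CharP F 2] (g k : Matrix (Fin 2) (Fin 2) F)
    (x : Fin 2 ⊕ Fin 2 → F) :
    thetaPlus F 2 ((tensorMatrix g k).mulVec x) = g.det * k.det * thetaPlus F 2 x := by
  simp only [thetaPlus_two, Matrix.mulVec, dotProduct, tensorMatrix, Fintype.sum_sum_type,
    Fin.sum_univ_two, Matrix.of_apply, Sum.elim_inl, Sum.elim_inr, id_eq, Equiv.swap_apply_left,
    Equiv.swap_apply_right, Matrix.det_fin_two, CharTwo.sub_eq_add]
  have h2 : (2 : F) = 0 := CharTwo.two_eq_zero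
  ring_nf
  simp only [h2, mul_zero, add_zero, zero_add]

theorem trace_toBlocks_two (w : Matrix (Fin 2 ⊕ Fin 2) (Fin 2 ⊕ Fin 2) F) :
    Matrix.trace (Matrix.toBlocks₁₂ w * (Matrix.toBlocks₂₁ w)ᵀ) =
      w (Sum.inl 0) (Sum.inr 0) * w (Sum.inr 0) (Sum.inl 0) +
      w (Sum.inl 0) (Sum.inr 1) * w (Sum.inr 0) (Sum.inl 1) +
      (w (Sum.inl 1) (Sum.inr 0) * w (Sum.inr 1) (Sum.inl 0) +
      w (Sum.inl 1) (Sum.inr 1) * w (Sum.inr 1) (Sum.inl 1)) := by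
  simp [Matrix.trace, Matrix.mul_apply, Matrix.toBlocks₁₂, Matrix.toBlocks₂₁]

theorem thetaPlus_add_two (x y : Fin 2 ⊕ Fin 2 → F) :
    thetaPlus F 2 (x + y) = thetaPlus F 2 x + thetaPlus F 2 y +
      (x (Sum.inl 0) * y (Sum.inr 0) + x (Sum.inr 0) * y (Sum.inl 0) +
        x (Sum.inl 1) * y (Sum.inr 1) + x (Sum.inr 1) * y (Sum.inl 1)) := by
  simp only [thetaPlus_two, Pi.add_apply]
  ring

section Isometry

variable {w : Matrix (Fin 2 ⊕ Fin 2) (Fin 2 ⊕ Fin 2) F}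
  (hw : ∀ x, thetaPlus F 2 (w.mulVec x) = thetaPlus F 2 x)

include hw

theorem thetaPlus_col (b : Fin 2 ⊕ Fin 2) :
    w (Sum.inl 0) b * w (Sum.inr 0) b + w (Sum.inl 1) b * w (Sum.inr 1) b = 0 := by
  have h := hw (Pi.single b 1)
  rw [Matrix.mulVec_single_one, thetaPlus_two, thetaPlus_two] at h
  refine h.trans ?_
  rcases b with b | b <;> fin_cases b <;> simp

theorem polar_col (b c : Fin 2 ⊕ Fin 2) :
    w (Sum.inl 0) b * w (Sum.inr 0) c + w (Sum.inr 0) b * w (Sum.inl 0) c +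
      w (Sum.inl 1) b * w (Sum.inr 1) c + w (Sum.inr 1) b * w (Sum.inl 1) c =
    if c = b.swap then 1 else 0 := by
  have h := hw (Pi.single b 1 + Pi.single c 1)
  rw [Matrix.mulVec_add, thetaPlus_add_two, thetaPlus_add_two, hw, hw] at h
  have h' := add_left_cancel h
  rw [Matrix.mulVec_single_one, Matrix.mulVec_single_one] at h'
  refine h'.trans ?_
  rcases b with b | b <;> rcases c with c | c <;> fin_cases b <;> fin_cases c <;> simp

end Isometry

theorem exists_specialLinearGroup_col {u v : F} (h : u ≠ 0 ∨ v ≠ 0) :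
    ∃ g : SpecialLinearGroup (Fin 2) F, g 0 0 = u ∧ g 1 0 = v := by
  by_cases hu : u = 0
  · have hv := h.resolve_left (not_not.2 hu)
    exact ⟨⟨!![0, -v⁻¹; v, 0], by simp [Matrix.det_fin_two_of, hv]⟩, by simp [hu], by simp⟩
  · exact ⟨⟨!![u, 0; v, u⁻¹], by simp [Matrix.det_fin_two_of, hu]⟩, by simp, by simp⟩

theorem exists_tensorMatrix_col [CharP F 2] {x : Fin 2 ⊕ Fin 2 → F} (hx : x ≠ 0)
    (hθ : x (Sum.inl 0) * x (Sum.inr 0) + x (Sum.inl 1) * x (Sum.inr 1) = 0) :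
    ∃ g k : SpecialLinearGroup (Fin 2) F, ∀ a,
      tensorMatrix (g : Matrix (Fin 2) (Fin 2) F) k a (Sum.inl 0) = x a := by
  obtain ⟨u, u', v, v', h1, h2, h3, h4⟩ : ∃ u u' v v', u * v = x (Sum.inl 0) ∧
      u * v' = x (Sum.inl 1) ∧ u' * v' = x (Sum.inr 0) ∧ u' * v = x (Sum.inr 1) := by
    have hθ' := CharTwo.add_eq_zero.1 hθ
    by_cases hx1 : x (Sum.inl 0) = 0
    · by_cases hx2 : x (Sum.inl 1) = 0
      · exact ⟨0, 1, x (Sum.inr 1), x (Sum.inr 0), by simp [hx1], by simp [hx2], by simp, by simp⟩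
      · refine ⟨1, x (Sum.inr 0) / x (Sum.inl 1), 0, x (Sum.inl 1), by simp [hx1], by simp,
          by field_simp, ?_⟩
        simpa [hx1, hx2, eq_comm] using hθ'
    · refine ⟨1, x (Sum.inr 1) / x (Sum.inl 0), x (Sum.inl 0), x (Sum.inl 1), by simp, by simp,
        ?_, by field_simp⟩
      field_simp
      linear_combination -hθ'
  have hne : ∃ a, x a ≠ 0 := Function.ne_iff.1 hx
  have hu : u ≠ 0 ∨ u' ≠ 0 := by
    by_contra! hc
    obtain ⟨a, ha⟩ := hne
    rcases a with a | a <;> fin_cases a <;>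
      simp [← h1, ← h2, ← h3, ← h4, hc.1, hc.2] at ha
  have hv : v ≠ 0 ∨ v' ≠ 0 := by
    by_contra! hc
    obtain ⟨a, ha⟩ := hne
    rcases a with a | a <;> fin_cases a <;>
      simp [← h1, ← h2, ← h3, ← h4, hc.1, hc.2] at ha
  obtain ⟨g, hg, hg'⟩ := exists_specialLinearGroup_col hu
  obtain ⟨k, hk, hk'⟩ := exists_specialLinearGroup_col hv
  refine ⟨g, k, fun a => ?_⟩
  rcases a with a | a <;> fin_cases a <;> simp [tensorMatrix, *]

/-- The tensor product action of `SL(2) × SL(2)` on `F⁴`. -/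
def tensorHom (F : Type) [Field F] :
    SpecialLinearGroup (Fin 2) F × SpecialLinearGroup (Fin 2) F →*
      Matrix (Fin 2 ⊕ Fin 2) (Fin 2 ⊕ Fin 2) F where
  toFun p := tensorMatrix (p.1 : Matrix (Fin 2) (Fin 2) F) p.2
  map_one' := tensorMatrix_one
  map_mul' p p' := by
    simp only [Prod.fst_mul, Prod.snd_mul, Matrix.SpecialLinearGroup.coe_mul, tensorMatrix_mul]

theorem tensorHom_apply (p : SpecialLinearGroup (Fin 2) F × SpecialLinearGroup (Fin 2) F) :
    tensorHom F p = tensorMatrix (p.1 : Matrix (Fin 2) (Fin 2) F) p.2 :=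
  rfl

theorem thetaPlus_tensorHom [CharP F 2]
    (p : SpecialLinearGroup (Fin 2) F × SpecialLinearGroup (Fin 2) F) (x : Fin 2 ⊕ Fin 2 → F) :
    thetaPlus F 2 ((tensorHom F p).mulVec x) = thetaPlus F 2 x := by
  rw [tensorHom_apply, thetaPlus_tensorMatrix, Matrix.SpecialLinearGroup.det_coe,
    Matrix.SpecialLinearGroup.det_coe, one_mul, one_mul]

theorem tensorHom_injective [CharP F 2] : Function.Injective (tensorHom F) := by
  rw [injective_iff_map_eq_one]
  rintro ⟨g, k⟩ h
  have h' := fun a b => congrFun (congrFun h a) b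
  have h00 := h' (Sum.inl 0) (Sum.inl 0)
  have h01 := h' (Sum.inl 0) (Sum.inl 1)
  have h10 := h' (Sum.inl 1) (Sum.inl 0)
  have h11 := h' (Sum.inl 1) (Sum.inl 1)
  have e01 := h' (Sum.inl 0) (Sum.inr 1)
  have e10 := h' (Sum.inr 1) (Sum.inl 0)
  have e11 := h' (Sum.inr 1) (Sum.inr 1)
  simp [tensorHom_apply, tensorMatrix] at h00 h01 h10 h11 e01 e10 e11
  have hg0 := left_ne_zero_of_mul_eq_one h00
  have hk0 := right_ne_zero_of_mul_eq_one h00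
  have hk01 := h01.resolve_left hg0
  have hk10 := h10.resolve_left hg0
  have hg01 := e01.resolve_right hk0
  have hg10 := e10.resolve_right hk0
  have hk11 : k 1 1 = k 0 0 := mul_left_cancel₀ hg0 (h11.trans h00.symm)
  have hg11 : g 1 1 = g 0 0 := mul_right_cancel₀ hk0 (e11.trans h00.symm)
  have hdg := g.det_coe
  have hdk := k.det_coe
  rw [Matrix.det_fin_two] at hdg hdk
  have hsq : ∀ x : F, x * x = 1 → x = 1 := fun x hx => by
    rcases mul_self_eq_one_iff.1 hx with h | h
    · exact h
    · rw [h, CharTwo.neg_eq]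
  have hg00 : g 0 0 = 1 := hsq _ (by simpa [hg11, hg01] using hdg)
  have hk00 : k 0 0 = 1 := hsq _ (by simpa [hk11, hk01] using hdk)
  refine Prod.ext ?_ ?_
  · ext i j
    fin_cases i <;> fin_cases j <;> simp [hg00, hg01, hg10, hg11]
  · ext i j
    fin_cases i <;> fin_cases j <;> simp [hk00, hk01, hk10, hk11]

theorem tensorHom_inv_mul (p : SpecialLinearGroup (Fin 2) F × SpecialLinearGroup (Fin 2) F)
    (w : Matrix (Fin 2 ⊕ Fin 2) (Fin 2 ⊕ Fin 2) F) :
    tensorHom F p * (tensorHom F p⁻¹ * w) = w := by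
  rw [← mul_assoc, ← map_mul, mul_inv_cancel, map_one, one_mul]

theorem exists_tensorHom_cols [CharP F 2] {w : Matrix (Fin 2 ⊕ Fin 2) (Fin 2 ⊕ Fin 2) F}
    (hw : ∀ x, thetaPlus F 2 (w.mulVec x) = thetaPlus F 2 x) :
    ∃ p, ∀ a, tensorHom F p a (Sum.inl 0) = w a (Sum.inl 0) ∧
      tensorHom F p a (Sum.inr 0) = w a (Sum.inr 0) := by
  have hx : w.col (Sum.inl 0) ≠ 0 := by
    intro h0
    have h1 := polar_col hw (Sum.inl 0) (Sum.inr 0)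
    have h2 : ∀ a, w a (Sum.inl 0) = 0 := fun a => congrFun h0 a
    simp [h2] at h1
  obtain ⟨g, k, hgk⟩ := exists_tensorMatrix_col hx (thetaPlus_col hw (Sum.inl 0))
  set v := tensorHom F (g, k)⁻¹ * w with hv
  have hvθ : ∀ x, thetaPlus F 2 (v.mulVec x) = thetaPlus F 2 x := fun x => by
    rw [hv, ← Matrix.mulVec_mulVec, thetaPlus_tensorHom, hw]
  have hwv : tensorHom F (g, k) * v = w := tensorHom_inv_mul _ _
  have hv1 : ∀ a, v a (Sum.inl 0) = (1 : Matrix (Fin 2 ⊕ Fin 2) (Fin 2 ⊕ Fin 2) F) a (Sum.inl 0) := by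
    intro a
    have h1 : w.col (Sum.inl 0) = (tensorHom F (g, k)).col (Sum.inl 0) :=
      funext fun a => (hgk a).symm
    have h2 : v.col (Sum.inl 0) = (1 : Matrix (Fin 2 ⊕ Fin 2) (Fin 2 ⊕ Fin 2) F).col (Sum.inl 0) := by
      rw [← Matrix.mulVec_single_one, hv, ← Matrix.mulVec_mulVec, Matrix.mulVec_single_one, h1,
        ← Matrix.mulVec_single_one, Matrix.mulVec_mulVec, ← map_mul, inv_mul_cancel, map_one,
        Matrix.mulVec_single_one]
    exact congrFun h2 a
  have h3 := polar_col hvθ (Sum.inl 0) (Sum.inr 0)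
  have h4 := thetaPlus_col hvθ (Sum.inr 0)
  simp [hv1] at h3
  rw [h3, mul_one, CharTwo.add_eq_zero] at h4
  let p' : SpecialLinearGroup (Fin 2) F × SpecialLinearGroup (Fin 2) F :=
    (⟨!![1, v (Sum.inl 1) (Sum.inr 0); 0, 1], by simp [Matrix.det_fin_two_of]⟩,
      ⟨!![1, v (Sum.inr 1) (Sum.inr 0); 0, 1], by simp [Matrix.det_fin_two_of]⟩)
  have hp' : ∀ a, tensorHom F p' a (Sum.inl 0) = v a (Sum.inl 0) ∧
      tensorHom F p' a (Sum.inr 0) = v a (Sum.inr 0) := by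
    intro a
    rcases a with a | a <;> fin_cases a <;> simp [tensorHom_apply, tensorMatrix, p', hv1, h3, h4]
  refine ⟨(g, k) * p', fun a => ?_⟩
  rw [map_mul, ← hwv, Matrix.mul_apply, Matrix.mul_apply, Matrix.mul_apply, Matrix.mul_apply]
  simp only [(hp' _).1, (hp' _).2, and_self]

theorem exists_tensorHom_eq [Finite F] [CharP F 2]
    {w : Matrix (Fin 2 ⊕ Fin 2) (Fin 2 ⊕ Fin 2) F}
    (hw : ∀ x, thetaPlus F 2 (w.mulVec x) = thetaPlus F 2 x)
    (hδ : Matrix.trace (Matrix.toBlocks₁₂ w * (Matrix.toBlocks₂₁ w)ᵀ) = 0) :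
    ∃ p, tensorHom F p = w := by
  obtain ⟨p, hp⟩ := exists_tensorHom_cols hw
  set v := tensorHom F p⁻¹ * w with hv
  have hvθ : ∀ x, thetaPlus F 2 (v.mulVec x) = thetaPlus F 2 x := fun x => by
    rw [hv, ← Matrix.mulVec_mulVec, thetaPlus_tensorHom, hw]
  have hwv : tensorHom F p * v = w := tensorHom_inv_mul _ _
  have hcol : ∀ b, (∀ a, tensorHom F p a b = w a b) →
      ∀ a, v a b = (1 : Matrix (Fin 2 ⊕ Fin 2) (Fin 2 ⊕ Fin 2) F) a b := by
    intro b hb a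
    have h1 : tensorHom F p⁻¹ * tensorHom F p = 1 := by
      rw [← map_mul, inv_mul_cancel, map_one]
    rw [← h1, hv, Matrix.mul_apply, Matrix.mul_apply]
    simp only [hb]
  have hv1 := hcol (Sum.inl 0) fun a => (hp a).1
  have hv3 := hcol (Sum.inr 0) fun a => (hp a).2
  have h21 := polar_col hvθ (Sum.inl 0) (Sum.inl 1)
  have h23 := polar_col hvθ (Sum.inr 0) (Sum.inl 1)
  have h41 := polar_col hvθ (Sum.inl 0) (Sum.inr 1)
  have h43 := polar_col hvθ (Sum.inr 0) (Sum.inr 1)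
  have h24 := polar_col hvθ (Sum.inl 1) (Sum.inr 1)
  have h2 := thetaPlus_col hvθ (Sum.inl 1)
  have h4 := thetaPlus_col hvθ (Sum.inr 1)
  simp [hv1, hv3] at h21 h23 h41 h43
  simp [h21, h23, h41, h43] at h24 h2 h4
  by_cases hs : v (Sum.inr 1) (Sum.inl 1) = 0
  · rw [hs, zero_mul, add_zero] at h24
    have ht := h4.resolve_right (right_ne_zero_of_mul_eq_one h24)
    obtain ⟨c, hc⟩ := FiniteField.isSquare_of_char_two (ringChar.eq F 2) (v (Sum.inl 1) (Sum.inl 1))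
    have hc0 : c ≠ 0 := by
      rintro rfl
      simp [hc] at h24
    have hu : v (Sum.inr 1) (Sum.inr 1) = c⁻¹ * c⁻¹ := by
      rw [hc] at h24
      field_simp
      linear_combination h24
    let p' : SpecialLinearGroup (Fin 2) F × SpecialLinearGroup (Fin 2) F :=
      (⟨!![c, 0; 0, c⁻¹], by simp [Matrix.det_fin_two_of, hc0]⟩,
        ⟨!![c⁻¹, 0; 0, c], by simp [Matrix.det_fin_two_of, hc0]⟩)
    refine ⟨p * p', ?_⟩
    rw [map_mul, ← hwv]
    congr 1
    ext a b
    rcases a with a | a <;> rcases b with b | b <;> fin_cases a <;> fin_cases b <;>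
      simp [tensorHom_apply, tensorMatrix, p', hv1, hv3, h21, h23, h41, h43, hs, ht, hc, hu, hc0]
  · exfalso
    have hp2 := h2.resolve_right hs
    rw [hp2, zero_mul, zero_add] at h24
    have hu := h4.resolve_left (right_ne_zero_of_mul_eq_one h24)
    have hdg := p.1.det_coe
    have hdk := p.2.det_coe
    rw [Matrix.det_fin_two] at hdg hdk
    rw [trace_toBlocks_two, ← hwv] at hδ
    simp [Matrix.mul_apply, tensorHom_apply, tensorMatrix, hv1, hv3, h21, h23, h41, h43, hp2,
      hu] at hδ
    have h2 : (2 : F) = 0 := CharTwo.two_eq_zero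
    refine one_ne_zero (α := F) ?_
    linear_combination hδ
      - p.1 0 0 * p.1 1 1 * (p.2 0 1 * p.2 1 0 + p.2 0 0 * p.2 1 1) * h24
      - (p.1 0 1 * p.1 1 0 * (p.2 0 0 * p.2 1 1) + p.1 0 0 * p.1 1 1 * (p.2 0 1 * p.2 1 0)) * h2
      - (p.2 0 0 * p.2 1 1 - p.2 0 1 * p.2 1 0) * hdg - hdk

variable [Fintype F] [DecidableEq F]

theorem mem_SOplusGrp_iff {n : ℕ} (w : Matrix (Fin n ⊕ Fin n) (Fin n ⊕ Fin n) F) :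
    w ∈ SOplusGrp F n ↔ (IsUnit w ∧ ∀ x, thetaPlus F n (w.mulVec x) = thetaPlus F n x) ∧
      Matrix.trace (Matrix.toBlocks₁₂ w * (Matrix.toBlocks₂₁ w)ᵀ) = 0 := by
  simp [SOplusGrp, OplusGrp]

theorem SOplusGrp_two_eq_image [CharP F 2] :
    SOplusGrp F 2 = Finset.univ.image (tensorHom F) := by
  ext w
  rw [mem_SOplusGrp_iff, Finset.mem_image]
  constructor
  · rintro ⟨⟨-, hw⟩, hδ⟩
    obtain ⟨p, hp⟩ := exists_tensorHom_eq hw hδ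
    exact ⟨p, Finset.mem_univ _, hp⟩
  · rintro ⟨p, -, rfl⟩
    refine ⟨⟨(Group.isUnit p).map (tensorHom F), thetaPlus_tensorHom p⟩, ?_⟩
    have h2 : (2 : F) = 0 := CharTwo.two_eq_zero
    rw [trace_toBlocks_two]
    simp only [tensorHom_apply, tensorMatrix, Matrix.of_apply, Sum.elim_inl, Sum.elim_inr, id_eq,
      Equiv.swap_apply_left, Equiv.swap_apply_right]
    ring_nf
    simp only [h2, mul_zero, add_zero]

theorem sum_SOplusGrp_two [CharP F 2] (f : F → ℤ) :
    ∑ w ∈ SOplusGrp F 2, f (Matrix.trace w) =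
      ∑ g : SpecialLinearGroup (Fin 2) F, ∑ k : SpecialLinearGroup (Fin 2) F,
        f (Matrix.trace (g : Matrix (Fin 2) (Fin 2) F) *
          Matrix.trace (k : Matrix (Fin 2) (Fin 2) F)) := by
  rw [SOplusGrp_two_eq_image, Finset.sum_image fun _ _ _ _ h => tensorHom_injective h,
    ← Fintype.sum_prod_type']
  exact Finset.sum_congr rfl fun p _ => by rw [tensorHom_apply, trace_tensorMatrix]

end OrthogonalGroup

theorem card_SOplusGrp_two {F : Type} [Field F] [Fintype F] [DecidableEq F] [CharP F 2]
    {r : ℕ} (hr : 1 ≤ r) (hF : Fintype.card F = 2 ^ r) :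
    ((SOplusGrp F 2).card : ℤ) = (2 ^ r * ((2 ^ r) ^ 2 - 1)) ^ 2 := by
  have h := sum_SOplusGrp_two (F := F) fun _ => 1
  simp only [Finset.sum_const, Finset.card_univ, nsmul_eq_mul, mul_one,
    card_specialLinearGroup_two hr hF] at h
  rw [h]
  ring

theorem sum_weight_pow_SOplusGrp_two {F : Type} [Field F] [Fintype F] [DecidableEq F] [CharP F 2]
    {r : ℕ} (hr : 1 ≤ r) (hF : Fintype.card F = 2 ^ r) {h : ℕ} (hh : 1 ≤ h) :
    2 ^ h * ∑ a : F, ((univ.filter fun g : SOplusGrp F 2 =>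
        lam F r (a * trace (g : Matrix (Fin 2 ⊕ Fin 2) (Fin 2 ⊕ Fin 2) F)) = -1).card : ℤ) ^ h =
      (2 ^ r) ^ (2 * h) * ∑ l ∈ range (h + 1), (-1) ^ l * (h.choose l : ℤ) *
        ((2 ^ r) ^ 4 - (2 ^ r) ^ 3 - 2 * (2 ^ r) ^ 2 + 2 ^ r + 1) ^ (h - l) * MK F r (2 * l) := by
  classical
  have hw : ∀ a : F, a ≠ 0 → 2 * ((univ.filter fun g : SOplusGrp F 2 =>
        lam F r (a * trace (g : Matrix (Fin 2 ⊕ Fin 2) (Fin 2 ⊕ Fin 2) F)) = -1).card : ℤ) =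
      (2 ^ r) ^ 2 * (-Kl F r a ^ 2 +
        ((2 ^ r) ^ 4 - (2 ^ r) ^ 3 - 2 * (2 ^ r) ^ 2 + 2 ^ r + 1)) := fun a ha => by
    rw [two_mul_card_eq_neg_one _ fun g => lam_eq_one_or_neg_one _,
      Finset.sum_coe_sort (SOplusGrp F 2) fun g => lam F r (a * trace g),
      sum_SOplusGrp_two fun x => lam F r (a * x), sum_lam_trace_mul_trace hr hF ha,
      Fintype.card_coe, card_SOplusGrp_two hr hF]
    ring
  rw [Finset.mul_sum, ← Finset.sum_filter_add_sum_filter_not univ fun a : F => a ≠ 0]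
  have h0 : ∑ a ∈ univ.filter (fun a : F => ¬ a ≠ 0), 2 ^ h * ((univ.filter fun g : SOplusGrp F 2 =>
        lam F r (a * trace (g : Matrix (Fin 2 ⊕ Fin 2) (Fin 2 ⊕ Fin 2) F)) = -1).card : ℤ) ^ h = 0 := by
    refine Finset.sum_eq_zero fun a ha => ?_
    obtain rfl : a = 0 := by simpa using ha
    simp [lam_zero, show h ≠ 0 by omega]
  rw [h0, add_zero]
  simp only [MK, Finset.mul_sum]
  rw [Finset.sum_comm]
  refine Finset.sum_congr (by ext; simp) fun a ha => ?_
  have ha0 : a ≠ 0 := by simpa using ha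
  rw [← mul_pow, hw a ha0, mul_pow, ← pow_mul, add_pow, Finset.mul_sum]
  refine Finset.sum_congr rfl fun l _ => ?_
  rw [neg_pow (Kl F r a ^ 2), ← pow_mul]
  ring

theorem stmt3 (r : ℕ) (hr : 2 ≤ r) (F : Type) [Field F] [Fintype F] [DecidableEq F]
    (hF : Fintype.card F = 2 ^ r) (N₃ : ℕ)
    (hN₃ : N₃ = 2 ^ (2 * r) * (2 ^ (2 * r) - 1) ^ 2)
    (h : ℕ) (hh : 1 ≤ h) :
    (SOplusGrp F 2).card = N₃ ∧
    (MK F r (2 * h) : ℚ) =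
      (∑ l ∈ Finset.range h,
        (-1 : ℚ) ^ (h + l + 1) * (h.choose l : ℚ) *
          ((2 ^ r : ℚ) ^ 4 - (2 ^ r : ℚ) ^ 3 - 2 * (2 ^ r : ℚ) ^ 2 + (2 ^ r : ℚ) + 1) ^ (h - l) *
          (MK F r (2 * l) : ℚ)) +
      (2 ^ r : ℚ) ^ (1 - 2 * (h : ℤ)) *
        ∑ j ∈ Finset.range (min N₃ h + 1),
          (-1 : ℚ) ^ (h + j) * (wtCount F (SOplusGrp F 2) j : ℚ) *
            ∑ t ∈ Finset.Icc j h,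
              (tS h t : ℚ) * 2 ^ (h - t) *
                (ichoose ((N₃ : ℤ) - (j : ℤ)) ((N₃ : ℤ) - (t : ℤ)) : ℚ) := by
  have : Fact (Nat.Prime 2) := ⟨Nat.prime_two⟩
  have : CharP F 2 := charP_of_card_eq_prime_pow hF
  have hr1 : 1 ≤ r := by omega
  have hcard : (SOplusGrp F 2).card = N₃ := by
    have h1 : 1 ≤ 2 ^ (2 * r) := Nat.one_le_two_pow
    zify [h1] at hN₃ ⊢
    rw [hN₃, card_SOplusGrp_two hr1 hF]
    ring
  refine ⟨hcard, ?_⟩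
  have key := (sum_weight_pow_SOplusGrp_two hr1 hF hh).symm.trans
    (two_pow_mul_sum_weight_pow hr1 hF (SOplusGrp F 2) h)
  rw [Finset.sum_range_succ, hcard] at key
  have keyQ := congrArg (Int.cast : ℤ → ℚ) key
  push_cast at keyQ
  have hq : (2 ^ r : ℚ) ≠ 0 := by positivity
  have hz : (2 ^ r : ℚ) ^ (1 - 2 * (h : ℤ)) = 2 ^ r / (2 ^ r) ^ (2 * h) := by
    rw [zpow_sub₀ hq, zpow_one]
    norm_cast
  have hs : ((-1 : ℚ) ^ h) * (-1) ^ h = 1 := by rw [← mul_pow]; norm_num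
  have hsum₁ : ∀ f g k : ℕ → ℚ, ∑ l ∈ Finset.range h, (-1 : ℚ) ^ (h + l + 1) * f l * g l * k l =
      -(-1) ^ h * ∑ l ∈ Finset.range h, (-1) ^ l * f l * g l * k l := fun f g k => by
    rw [Finset.mul_sum]
    exact Finset.sum_congr rfl fun l _ => by ring
  have hsum₂ : ∀ (n : ℕ) (f g : ℕ → ℚ), ∑ j ∈ Finset.range n, (-1 : ℚ) ^ (h + j) * f j * g j =
      (-1) ^ h * ∑ j ∈ Finset.range n, (-1) ^ j * f j * g j := fun n f g => by
    rw [Finset.mul_sum]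
    exact Finset.sum_congr rfl fun l _ => by ring
  rw [hsum₁, hsum₂, hz]
  simp only [Nat.choose_self, Nat.sub_self, pow_zero, Nat.cast_one, mul_one] at keyQ
  set X := ∑ l ∈ Finset.range h, (-1 : ℚ) ^ l * (h.choose l : ℚ) *
    ((2 ^ r : ℚ) ^ 4 - (2 ^ r : ℚ) ^ 3 - 2 * (2 ^ r : ℚ) ^ 2 + (2 ^ r : ℚ) + 1) ^ (h - l) *
      (MK F r (2 * l) : ℚ)
  set Y := ∑ j ∈ Finset.range (min N₃ h + 1), (-1 : ℚ) ^ j * (wtCount F (SOplusGrp F 2) j : ℚ) * _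
  have hX : X + (-1) ^ h * (MK F r (2 * h) : ℚ) = 2 ^ r / (2 ^ r) ^ (2 * h) * Y := by
    field_simp
    linear_combination keyQ
  linear_combination (-1) ^ h * hX - (MK F r (2 * h) : ℚ) * hs
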